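/- arXiv:2310.07042 — 2 statements merged into one kernel-verified Lean document; each statement's English description precedes it below -/
import Mathlib

section
/- Define on (0,1) the potentials V₁(ρ) = −5(21ρ⁶ − 375ρ⁴ + 1455ρ² − 2125)/((5+3ρ²)²(5−ρ²)²), V₂(ρ) = −2(3ρ² − 35)/((5+3ρ²)(5−ρ²)), Ṽ(ρ) = −2(9ρ⁴ + 102ρ² − 335)/(5+3ρ²)², and γ(ρ) = √(5−ρ²)/(5+3ρ²). For pairs of smooth functions (u₁,u₂) on (0,1) define the operators L₀(u₁,u₂) = (−ρu₁′ − u₁ + u₂, u₁″ + (6/ρ)u₁′ − ρu₂′ − 4u₂), L′(u₁,u₂) = (0, V₁u₁ + V₂(ρ²u₂ − ρu₁′)), Γ(u₁,u₂) = γ·(u₁, −(1/2)ρ²V₂u₁ + u₂), and Γ⁻¹(u₁,u₂) = γ⁻¹·(u₁, (1/2)ρ²V₂u₁ + u₂). Then Γ∘Γ⁻¹ = Γ⁻¹∘Γ = identity, and for every pair of smooth functions (u₁,u₂) on (0,1) the conjugation identity Γ((L₀ + L′)(Γ⁻¹(u₁,u₂))) = L₀(u₁,u₂) + (0, Ṽ·u₁)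 holds pointwise on (0,1). -/
/-- The potential `V₁`. -/
noncomputable def V1 (ρ : ℝ) : ℝ :=
  -5 * (21 * ρ ^ 6 - 375 * ρ ^ 4 + 1455 * ρ ^ 2 - 2125) /
    ((5 + 3 * ρ ^ 2) ^ 2 * (5 - ρ ^ 2) ^ 2)

/-- The potential `V₂`. -/
noncomputable def V2 (ρ : ℝ) : ℝ :=
  -2 * (3 * ρ ^ 2 - 35) / ((5 + 3 * ρ ^ 2) * (5 - ρ ^ 2))

/-- The potential `Ṽ`. -/
noncomputable def Vt (ρ : ℝ) : ℝ :=
  -2 * (9 * ρ ^ 4 + 102 * ρ ^ 2 - 335) / (5 + 3 * ρ ^ 2) ^ 2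

/-- The weight `γ(ρ) = √(5-ρ²)/(5+3ρ²)`. -/
noncomputable def gam (ρ : ℝ) : ℝ := Real.sqrt (5 - ρ ^ 2) / (5 + 3 * ρ ^ 2)

/-- The free operator `L₀(u₁,u₂) = (−ρu₁′ − u₁ + u₂, u₁″ + (6/ρ)u₁′ − ρu₂′ − 4u₂)`. -/
noncomputable def L0 (u : (ℝ → ℝ) × (ℝ → ℝ)) : (ℝ → ℝ) × (ℝ → ℝ) :=
  (fun ρ => -ρ * deriv u.1 ρ - u.1 ρ + u.2 ρ,
   fun ρ => deriv (deriv u.1) ρ + 6 / ρ * deriv u.1 ρ - ρ * deriv u.2 ρ - 4 * u.2 ρ)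

/-- The perturbation `L′(u₁,u₂) = (0, V₁u₁ + V₂(ρ²u₂ − ρu₁′))`. -/
noncomputable def Lp (u : (ℝ → ℝ) × (ℝ → ℝ)) : (ℝ → ℝ) × (ℝ → ℝ) :=
  (fun _ => 0,
   fun ρ => V1 ρ * u.1 ρ + V2 ρ * (ρ ^ 2 * u.2 ρ - ρ * deriv u.1 ρ))

/-- The sum `L₀ + L′` acting componentwise. -/
noncomputable def L0pLp (u : (ℝ → ℝ) × (ℝ → ℝ)) : (ℝ → ℝ) × (ℝ → ℝ) :=
  (fun ρ => (L0 u).1 ρ + (Lp u).1 ρ, fun ρ => (L0 u).2 ρ + (Lp u).2 ρ)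

/-- The transformation `Γ(u₁,u₂) = γ·(u₁, −(1/2)ρ²V₂u₁ + u₂)`. -/
noncomputable def Gam (u : (ℝ → ℝ) × (ℝ → ℝ)) : (ℝ → ℝ) × (ℝ → ℝ) :=
  (fun ρ => gam ρ * u.1 ρ,
   fun ρ => gam ρ * (-(1 / 2) * ρ ^ 2 * V2 ρ * u.1 ρ + u.2 ρ))

/-- The inverse transformation `Γ⁻¹(u₁,u₂) = γ⁻¹·(u₁, (1/2)ρ²V₂u₁ + u₂)`. -/
noncomputable def GamInv (u : (ℝ → ℝ) × (ℝ → ℝ)) : (ℝ → ℝ) × (ℝ → ℝ) :=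
  (fun ρ => (gam ρ)⁻¹ * u.1 ρ,
   fun ρ => (gam ρ)⁻¹ * (1 / 2 * ρ ^ 2 * V2 ρ * u.1 ρ + u.2 ρ))

lemma gam_pos {ρ : ℝ} (hρ : ρ ∈ Set.Ioo (0 : ℝ) 1) : 0 < gam ρ := by
  have h5 : 0 < 5 - ρ ^ 2 := by nlinarith [hρ.1, hρ.2]
  unfold gam
  positivity

/-- The logarithmic derivative of `γ⁻¹` is `ρV₂/2`. -/
lemma hasDerivAt_inv_gam {ρ : ℝ} (hρ : ρ ∈ Set.Ioo (0 : ℝ) 1) :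
    HasDerivAt (fun r => (gam r)⁻¹) ((gam ρ)⁻¹ * (ρ * V2 ρ / 2)) ρ := by
  have h5 : 0 < 5 - ρ ^ 2 := by nlinarith [hρ.1, hρ.2]
  have h3 : 0 < 5 + 3 * ρ ^ 2 := by positivity
  have hs : 0 < √(5 - ρ ^ 2) := Real.sqrt_pos.2 h5
  have hsq : √(5 - ρ ^ 2) ^ 2 = 5 - ρ ^ 2 := Real.sq_sqrt h5.le
  have hnum : HasDerivAt (fun r : ℝ => 5 + 3 * r ^ 2) (6 * ρ) ρ := by
    refine (((hasDerivAt_pow 2 ρ).const_mul 3).const_add 5).congr_deriv ?_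
    norm_num
    ring
  have hden : HasDerivAt (fun r : ℝ => √(5 - r ^ 2)) (-(2 * ρ) / (2 * √(5 - ρ ^ 2))) ρ := by
    refine (((hasDerivAt_pow 2 ρ).const_sub 5).sqrt h5.ne').congr_deriv ?_
    norm_num
  have h := hnum.div hden hs.ne'
  have hfun : (fun r => (gam r)⁻¹) = (fun r : ℝ => 5 + 3 * r ^ 2) / fun r => √(5 - r ^ 2) := by
    funext r
    simp [gam]
  rw [hfun]
  refine h.congr_deriv ?_
  simp only [gam, V2]
  rw [inv_div]
  field_simp
  rw [hsq]
  ring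

lemma hasDerivAt_V2 {ρ : ℝ} (hρ : ρ ∈ Set.Ioo (0 : ℝ) 1) :
    HasDerivAt V2
      ((-12 * ρ * ((5 + 3 * ρ ^ 2) * (5 - ρ ^ 2)) +
        2 * (3 * ρ ^ 2 - 35) * (20 * ρ - 12 * ρ ^ 3)) /
          ((5 + 3 * ρ ^ 2) * (5 - ρ ^ 2)) ^ 2) ρ := by
  have h5 : 0 < 5 - ρ ^ 2 := by nlinarith [hρ.1, hρ.2]
  have h3 : 0 < 5 + 3 * ρ ^ 2 := by positivity
  have hsq : HasDerivAt (fun r : ℝ => r ^ 2) (2 * ρ) ρ := by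
    simpa using hasDerivAt_pow 2 ρ
  have h := (((hsq.const_mul 3).sub_const 35).const_mul (-2)).fun_div
    (((hsq.const_mul 3).const_add 5).fun_mul (hsq.const_sub 5)) (mul_pos h3 h5).ne'
  exact h.congr_deriv (by ring)

/-- The Riccati-type identity relating the three potentials. -/
lemma potential_identity {ρ : ℝ} (hρ : ρ ∈ Set.Ioo (0 : ℝ) 1) :
    (1 - ρ ^ 2) * ((V2 ρ + ρ * deriv V2 ρ) / 2 - (ρ * V2 ρ / 2) ^ 2) + 3 * V2 ρ
      - 2 * ρ ^ 2 * V2 ρ + V1 ρ = Vt ρ := by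
  have h5 : 5 - ρ ^ 2 ≠ 0 := by nlinarith [hρ.1, hρ.2]
  have h3 : 5 + 3 * ρ ^ 2 ≠ 0 := by positivity
  rw [(hasDerivAt_V2 hρ).deriv]
  simp only [V1, V2, Vt]
  field_simp
  ring

/-- `Γ∘Γ⁻¹ = Γ⁻¹∘Γ = id` on `(0,1)`, and for smooth pairs the conjugation identity
`Γ((L₀+L′)(Γ⁻¹u)) = L₀u + (0, Ṽ·u₁)` holds pointwise on `(0,1)`. -/
theorem stmt_7 (u : (ℝ → ℝ) × (ℝ → ℝ))
    (h1 : ContDiffOn ℝ (⊤ : ℕ∞) u.1 (Set.Ioo 0 1))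
    (h2 : ContDiffOn ℝ (⊤ : ℕ∞) u.2 (Set.Ioo 0 1)) :
    (∀ v : (ℝ → ℝ) × (ℝ → ℝ), ∀ ρ ∈ Set.Ioo (0 : ℝ) 1,
      (Gam (GamInv v)).1 ρ = v.1 ρ ∧ (Gam (GamInv v)).2 ρ = v.2 ρ ∧
      (GamInv (Gam v)).1 ρ = v.1 ρ ∧ (GamInv (Gam v)).2 ρ = v.2 ρ) ∧
    (∀ ρ ∈ Set.Ioo (0 : ℝ) 1,
      (Gam (L0pLp (GamInv u))).1 ρ = (L0 u).1 ρ ∧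
      (Gam (L0pLp (GamInv u))).2 ρ = (L0 u).2 ρ + Vt ρ * u.1 ρ) := by
  refine ⟨fun v ρ hρ => ?_, fun ρ hρ => ?_⟩
  · have hg := (gam_pos hρ).ne'
    simp only [Gam, GamInv]
    refine ⟨?_, ?_, ?_, ?_⟩ <;> field_simp <;> ring
  have hmem : ∀ r ∈ Set.Ioo (0 : ℝ) 1, Set.Ioo (0 : ℝ) 1 ∈ nhds r := fun r hr =>
    isOpen_Ioo.mem_nhds hr
  have hu₁ : ∀ r ∈ Set.Ioo (0 : ℝ) 1, HasDerivAt u.1 (deriv u.1 r) r := fun r hr =>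
    ((h1.contDiffAt (hmem r hr)).differentiableAt (by simp)).hasDerivAt
  have hu₂ : HasDerivAt u.2 (deriv u.2 ρ) ρ :=
    ((h2.contDiffAt (hmem ρ hρ)).differentiableAt (by simp)).hasDerivAt
  have hu₁' : HasDerivAt (deriv u.1) (deriv (deriv u.1) ρ) ρ :=
    (((h1.deriv_of_isOpen isOpen_Ioo (m := 1) (by norm_cast)).contDiffAt
      (hmem ρ hρ)).differentiableAt (by simp)).hasDerivAt
  have hV : HasDerivAt V2 (deriv V2 ρ) ρ := (hasDerivAt_V2 hρ).differentiableAt.hasDerivAt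
  have hw₁ : ∀ r ∈ Set.Ioo (0 : ℝ) 1, deriv (GamInv u).1 r =
      (gam r)⁻¹ * (r * V2 r / 2) * u.1 r + (gam r)⁻¹ * deriv u.1 r := fun r hr =>
    ((hasDerivAt_inv_gam hr).fun_mul (hu₁ r hr)).deriv
  have hg := hasDerivAt_inv_gam hρ
  have hw₁' : deriv (deriv (GamInv u).1) ρ = _ :=
    (Filter.eventuallyEq_of_mem (hmem ρ hρ) hw₁).deriv_eq.trans
      (((hg.fun_mul (((hasDerivAt_id' ρ).fun_mul hV).div_const 2)).fun_mul (hu₁ ρ hρ)).fun_add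
        (hg.fun_mul hu₁')).deriv
  have hw₂ : deriv (GamInv u).2 ρ = _ :=
    (hg.fun_mul ((((((hasDerivAt_pow 2 ρ).const_mul (1 / 2)).fun_mul hV).fun_mul
      (hu₁ ρ hρ)).fun_add hu₂))).deriv
  have hγ := (gam_pos hρ).ne'
  have hρ0 : ρ ≠ 0 := hρ.1.ne'
  simp only [Gam, L0pLp, L0, Lp, hw₁', hw₂, hw₁ ρ hρ, ← potential_identity hρ]
  simp only [GamInv]
  constructor <;> field_simp <;> norm_num <;> ring
end

section
/- (Mode stability.) Let λ ∈ ℂ with Re λ ≥ 0 and suppose f : [0,1] → ℂ is infinitely differentiable on the closed interval [0,1], not identically zero, and solves the spectral ODE −(1−ρ²)f″(ρ) − (6/ρ − 2(λ+3)ρ)f′(ρ) + ((λ+1)(λ+4) − Ṽ(ρ))f(ρ) = 0 for all ρ ∈ (0,1). Then λ = 1 and there exists c ∈ ℂ, c ≠ 0, such that f(ρ) = c·(5+3ρ²)⁻² for all ρ ∈ [0,1]. -/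
open Set

/-- The reciprocal of the potential obtained from `Vt` by a Darboux transformation, in the
variable `ρ`. -/
noncomputable def darbouxWeight (ρ : ℝ) : ℝ :=
  ρ ^ 2 * (5 + 3 * ρ ^ 2) ^ 2 / (6 * (50 - 15 * ρ ^ 2 - 3 * ρ ^ 6))

lemma darbouxWeight_denom_pos {ρ : ℝ} (h : ρ ∈ Icc (0 : ℝ) 1) :
    0 < 50 - 15 * ρ ^ 2 - 3 * ρ ^ 6 := by
  have h2 : ρ ^ 2 ≤ 1 := pow_le_one₀ h.1 h.2
  have h6 : ρ ^ 6 ≤ 1 := pow_le_one₀ h.1 h.2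
  linarith

lemma continuousOn_darbouxWeight : ContinuousOn darbouxWeight (Icc 0 1) := by
  unfold darbouxWeight
  refine ContinuousOn.div (by fun_prop) (by fun_prop) fun ρ hρ => ?_
  have := darbouxWeight_denom_pos hρ
  positivity

lemma darbouxWeight_pos {ρ : ℝ} (h : ρ ∈ Ioo (0 : ℝ) 1) : 0 < darbouxWeight ρ := by
  have h0 := h.1
  have := darbouxWeight_denom_pos (Ioo_subset_Icc_self h)
  unfold darbouxWeight
  positivity

lemma exists_hasDerivAt_darbouxWeight {ρ : ℝ} (h : ρ ∈ Ioo (0 : ℝ) 1) :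
    ∃ p', HasDerivAt darbouxWeight p' ρ ∧ 2 * darbouxWeight ρ < p' * (1 + ρ) := by
  have h0 := h.1
  have hD := darbouxWeight_denom_pos (Ioo_subset_Icc_self h)
  have hp := darbouxWeight_pos h
  have hid := hasDerivAt_id ρ
  have key := ((hid.pow 2).mul ((((hid.pow 2).const_mul 3).const_add 5).pow 2)).div
    ((((hid.pow 2).const_mul 15).const_sub 50).sub ((hid.pow 6).const_mul 3) |>.const_mul 6)
    (by simp only [Pi.pow_apply, Pi.sub_apply, id]; positivity)
  refine ⟨darbouxWeight ρ * (2 / ρ + 12 * ρ / (5 + 3 * ρ ^ 2)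
    + (30 * ρ + 18 * ρ ^ 5) / (50 - 15 * ρ ^ 2 - 3 * ρ ^ 6)), ?_, ?_⟩
  · refine (key.congr_of_eventuallyEq ?_).congr_deriv ?_
    · exact Filter.Eventually.of_forall fun t => by simp [darbouxWeight]
    · have h5 : (5 + 3 * ρ ^ 2) ≠ 0 := by positivity
      have hD' := hD.ne'
      have hr := h0.ne'
      simp only [darbouxWeight, Pi.mul_apply, Pi.pow_apply, Pi.sub_apply, id]
      obtain ⟨D, hDef⟩ : ∃ D, D = 50 - 15 * ρ ^ 2 - 3 * ρ ^ 6 := ⟨_, rfl⟩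
      rw [← hDef] at hD' ⊢
      field_simp
      rw [hDef]
      ring
  · have h1 : 2 / ρ * (1 + ρ) = 2 + 2 / ρ := by field_simp; ring
    have h2 : 0 ≤ (12 * ρ / (5 + 3 * ρ ^ 2)
      + (30 * ρ + 18 * ρ ^ 5) / (50 - 15 * ρ ^ 2 - 3 * ρ ^ 6)) * (1 + ρ) := by positivity
    have h3 : 0 < 2 / ρ := by positivity
    rw [mul_assoc, mul_comm 2]
    refine mul_lt_mul_of_pos_left ?_ hp
    linarith

lemma deriv_darbouxWeight_add_pos {σ ρ : ℝ} (hσ : -1 ≤ σ) (h : ρ ∈ Ioo (0 : ℝ) 1) :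
    0 < deriv darbouxWeight ρ + 2 * darbouxWeight ρ * (ρ + σ) / (1 - ρ ^ 2) := by
  obtain ⟨p', hp', hlt⟩ := exists_hasDerivAt_darbouxWeight h
  have hp := darbouxWeight_pos h
  have h1 : 0 < 1 - ρ := by linarith [h.2]
  have h2 : 0 < 1 + ρ := by linarith [h.1]
  have h3 : deriv darbouxWeight ρ + 2 * darbouxWeight ρ * (ρ + σ) / (1 - ρ ^ 2)
      = ((p' * (1 + ρ) - 2 * darbouxWeight ρ) * (1 - ρ) + 2 * darbouxWeight ρ * (1 + σ))
        / ((1 - ρ) * (1 + ρ)) := by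
    rw [hp'.deriv, show 1 - ρ ^ 2 = (1 - ρ) * (1 + ρ) by ring]
    field_simp
    ring
  rw [h3]
  have h4 : 0 < p' * (1 + ρ) - 2 * darbouxWeight ρ := by linarith
  have h5 : 0 ≤ 1 + σ := by linarith
  positivity

/-- A function with nonnegative derivative that vanishes at `0` and is nonpositive at `1` has
vanishing derivative. -/
lemma deriv_eq_zero_of_squeezed {N N' : ℝ → ℝ} (hc : ContinuousOn N (Icc 0 1))
    (hd : ∀ ρ ∈ Ioo (0 : ℝ) 1, HasDerivAt N (N' ρ) ρ) (hn : ∀ ρ ∈ Ioo (0 : ℝ) 1, 0 ≤ N' ρ)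
    (h0 : N 0 = 0) (h1 : N 1 ≤ 0) : ∀ ρ ∈ Ioo (0 : ℝ) 1, N' ρ = 0 := by
  have hm : MonotoneOn N (Icc 0 1) := by
    refine monotoneOn_of_deriv_nonneg (convex_Icc 0 1) hc ?_ ?_
    · rw [interior_Icc]
      exact fun ρ hρ => (hd ρ hρ).differentiableAt.differentiableWithinAt
    · rw [interior_Icc]
      exact fun ρ hρ => (hd ρ hρ).deriv ▸ hn ρ hρ
  intro ρ hρ
  have hz : N =ᶠ[nhds ρ] fun _ => 0 := by
    filter_upwards [isOpen_Ioo.mem_nhds hρ] with t ht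
    have ht' := Ioo_subset_Icc_self ht
    have ha := hm (left_mem_Icc.2 zero_le_one) ht' ht'.1
    have hb := hm ht' (right_mem_Icc.2 zero_le_one) ht'.2
    linarith
  exact (hd ρ hρ).unique ((hasDerivAt_const ρ (0 : ℝ)).congr_of_eventuallyEq hz)

/-- The integrating factor of the energy identities. -/
noncomputable def energyWeight (σ ρ : ℝ) : ℝ := (1 - ρ) ^ (1 + σ) * (1 + ρ) ^ (1 - σ)

lemma continuousOn_energyWeight {σ : ℝ} (hσ : -1 ≤ σ) :
    ContinuousOn (energyWeight σ) (Icc 0 1) := by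
  unfold energyWeight
  refine ContinuousOn.mul ?_ ?_
  · exact ContinuousOn.rpow_const (by fun_prop) fun ρ _ => Or.inr (by linarith)
  · exact ContinuousOn.rpow_const (by fun_prop) fun ρ hρ => Or.inl (by linarith [hρ.1])

lemma energyWeight_pos (σ : ℝ) {ρ : ℝ} (h : ρ ∈ Ioo (0 : ℝ) 1) : 0 < energyWeight σ ρ :=
  mul_pos (Real.rpow_pos_of_pos (by linarith [h.2]) _) (Real.rpow_pos_of_pos (by linarith [h.1]) _)

lemma energyWeight_one_nonneg (σ : ℝ) : 0 ≤ energyWeight σ 1 := by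
  unfold energyWeight
  positivity

lemma energyWeight_one {σ : ℝ} (hσ : -1 < σ) : energyWeight σ 1 = 0 := by
  simp [energyWeight, Real.zero_rpow (by linarith : 1 + σ ≠ 0)]

lemma hasDerivAt_energyWeight (σ : ℝ) {ρ : ℝ} (h : ρ ∈ Ioo (0 : ℝ) 1) :
    HasDerivAt (energyWeight σ) (energyWeight σ ρ * (-2 * (ρ + σ) / (1 - ρ ^ 2))) ρ := by
  have hm : 0 < 1 - ρ := by linarith [h.2]
  have hp : 0 < 1 + ρ := by linarith [h.1]
  have hmp : 1 - ρ ^ 2 ≠ 0 := by nlinarith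
  have hid := hasDerivAt_id ρ
  refine (((hid.const_sub 1).rpow_const (p := 1 + σ) (Or.inl hm.ne')).mul
    ((hid.const_add 1).rpow_const (p := 1 - σ) (Or.inl hp.ne'))).congr_deriv ?_
  simp only [id, energyWeight, Real.rpow_sub_one hm.ne', Real.rpow_sub_one hp.ne']
  have hf : 1 - ρ ^ 2 = (1 - ρ) * (1 + ρ) := by ring
  rw [hf]
  field_simp
  ring

/-- The Darboux-transformed equation has no nontrivial solution regular at both endpoints. -/
lemma darboux_solution_eq_zero {κ : ℂ} (hκ : -1 ≤ κ.re) {χ y : ℝ → ℂ}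
    (hχc : ContinuousOn χ (Icc 0 1)) (hyc : ContinuousOn y (Icc 0 1)) (hχ0 : χ 0 = 0)
    (hχ : ∀ ρ ∈ Ioo (0 : ℝ) 1, HasDerivAt χ (y ρ) ρ)
    (hy : ∀ ρ ∈ Ioo (0 : ℝ) 1, HasDerivAt y
      ((2 * (ρ + κ) * y ρ + χ ρ / (darbouxWeight ρ : ℂ)) / ((1 - ρ ^ 2 : ℝ) : ℂ)) ρ)
    (h1 : -2 * (1 + κ) * y 1 = 3 * χ 1) : ∀ ρ ∈ Ioo (0 : ℝ) 1, χ ρ = 0 := by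
  have hre : ∀ {g : ℝ → ℂ} {g' : ℂ} {t : ℝ}, HasDerivAt g g' t →
      HasDerivAt (fun s => (g s).re) g'.re t := fun hg =>
    Complex.reCLM.hasFDerivAt.comp_hasDerivAt _ hg
  have him : ∀ {g : ℝ → ℂ} {g' : ℂ} {t : ℝ}, HasDerivAt g g' t →
      HasDerivAt (fun s => (g s).im) g'.im t := fun hg =>
    Complex.imCLM.hasFDerivAt.comp_hasDerivAt _ hg
  have hrec : ∀ {g : ℝ → ℂ} {s : Set ℝ}, ContinuousOn g s →
      ContinuousOn (fun s => (g s).re) s := fun hg => Complex.continuous_re.comp_continuousOn hg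
  have himc : ∀ {g : ℝ → ℂ} {s : Set ℝ}, ContinuousOn g s →
      ContinuousOn (fun s => (g s).im) s := fun hg => Complex.continuous_im.comp_continuousOn hg
  have hΘc := continuousOn_energyWeight hκ
  have hyre : ∀ ρ ∈ Ioo (0 : ℝ) 1, HasDerivAt (fun s => (y s).re)
      ((2 * (ρ + κ.re) * (y ρ).re - 2 * κ.im * (y ρ).im + (χ ρ).re / darbouxWeight ρ)
        / (1 - ρ ^ 2)) ρ := fun ρ hρ => (hre (hy ρ hρ)).congr_deriv (by
    rw [Complex.div_ofReal_re]; simp [Complex.div_ofReal_re])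
  have hyim : ∀ ρ ∈ Ioo (0 : ℝ) 1, HasDerivAt (fun s => (y s).im)
      ((2 * (ρ + κ.re) * (y ρ).im + 2 * κ.im * (y ρ).re + (χ ρ).im / darbouxWeight ρ)
        / (1 - ρ ^ 2)) ρ := fun ρ hρ => (him (hy ρ hρ)).congr_deriv (by
    rw [Complex.div_ofReal_im]; simp [Complex.div_ofReal_im])
  have hsq : ∀ ρ ∈ Ioo (0 : ℝ) 1, 0 < 1 - ρ ^ 2 := fun ρ hρ => by nlinarith [hρ.1, hρ.2]
  have h1re : -2 * ((1 + κ.re) * (y 1).re - κ.im * (y 1).im) = 3 * (χ 1).re := by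
    simpa [mul_assoc] using congrArg Complex.re h1
  have h1im : -2 * ((1 + κ.re) * (y 1).im + κ.im * (y 1).re) = 3 * (χ 1).im := by
    simpa [mul_assoc] using congrArg Complex.im h1
  rcases eq_or_ne κ.im 0 with hτ | hτ
  · have hN := deriv_eq_zero_of_squeezed
      (N := fun ρ => energyWeight κ.re ρ * ((χ ρ).re * (y ρ).re + (χ ρ).im * (y ρ).im))
      (N' := fun ρ => energyWeight κ.re ρ * ((y ρ).re ^ 2 + (y ρ).im ^ 2
        + ((χ ρ).re ^ 2 + (χ ρ).im ^ 2) / darbouxWeight ρ / (1 - ρ ^ 2)))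
      (hΘc.mul (((hrec hχc).mul (hrec hyc)).add ((himc hχc).mul (himc hyc))))
      (fun ρ hρ => by
        have hw := (darbouxWeight_pos hρ).ne'
        have hq := (hsq ρ hρ).ne'
        refine ((hasDerivAt_energyWeight κ.re hρ).mul
          (((hre (hχ ρ hρ)).mul (hyre ρ hρ)).add
            ((him (hχ ρ hρ)).mul (hyim ρ hρ)))).congr_deriv ?_
        simp only [hτ, Pi.mul_apply, Pi.add_apply]
        field_simp
        ring)
      (fun ρ hρ => by
        have := energyWeight_pos κ.re hρ
        have := darbouxWeight_pos hρ
        have := hsq ρ hρ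
        positivity)
      (by simp [hχ0])
      (by
        rcases hκ.lt_or_eq with h | h
        · simp [energyWeight_one h]
        · rw [hτ, ← h] at h1re h1im
          have ha : (χ 1).re = 0 := by linarith
          have hb : (χ 1).im = 0 := by linarith
          simp [ha, hb])
    intro ρ hρ
    have hw := darbouxWeight_pos hρ
    have hq := hsq ρ hρ
    have h0 := (mul_eq_zero.1 (hN ρ hρ)).resolve_left (energyWeight_pos κ.re hρ).ne'
    have h2 : ((χ ρ).re ^ 2 + (χ ρ).im ^ 2) / darbouxWeight ρ / (1 - ρ ^ 2) = 0 :=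
      le_antisymm (by nlinarith [sq_nonneg (y ρ).re, sq_nonneg (y ρ).im]) (by positivity)
    have h3 : (χ ρ).re ^ 2 + (χ ρ).im ^ 2 = 0 := by
      simpa [hw.ne', hq.ne'] using h2
    apply Complex.ext <;> simp only [Complex.zero_re, Complex.zero_im] <;> nlinarith
  · have hN := deriv_eq_zero_of_squeezed
      (N := fun ρ => energyWeight κ.re ρ * (darbouxWeight ρ * ((y ρ).re ^ 2 + (y ρ).im ^ 2)
        + ((χ ρ).im * (y ρ).re - (χ ρ).re * (y ρ).im) / κ.im))
      (N' := fun ρ => energyWeight κ.re ρ * ((y ρ).re ^ 2 + (y ρ).im ^ 2) *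
        (deriv darbouxWeight ρ + 2 * darbouxWeight ρ * (ρ + κ.re) / (1 - ρ ^ 2)))
      (hΘc.mul ((continuousOn_darbouxWeight.mul (((hrec hyc).pow 2).add ((himc hyc).pow 2))).add
        ((((himc hχc).mul (hrec hyc)).sub ((hrec hχc).mul (himc hyc))).div_const _)))
      (fun ρ hρ => by
        have hw := (darbouxWeight_pos hρ).ne'
        have hq := (hsq ρ hρ).ne'
        obtain ⟨p', hp', -⟩ := exists_hasDerivAt_darbouxWeight hρ
        refine ((hasDerivAt_energyWeight κ.re hρ).mul
          ((hp'.mul (((hyre ρ hρ).pow 2).add ((hyim ρ hρ).pow 2))).add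
            ((((him (hχ ρ hρ)).mul (hyre ρ hρ)).sub
              ((hre (hχ ρ hρ)).mul (hyim ρ hρ))).div_const κ.im))).congr_deriv ?_
        simp only [hp'.deriv, Pi.mul_apply, Pi.add_apply, Pi.sub_apply, Pi.pow_apply]
        field_simp
        push_cast
        ring)
      (fun ρ hρ => by
        have := energyWeight_pos κ.re hρ
        exact mul_nonneg (by positivity) (deriv_darbouxWeight_add_pos hκ hρ).le)
      (by simp [hχ0, darbouxWeight])
      (by
        rcases hκ.lt_or_eq with h | h
        · simp [energyWeight_one h]
        · rw [← h] at h1re h1im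
          have ha : (χ 1).re = 2 / 3 * (κ.im * (y 1).im) := by linarith
          have hb : (χ 1).im = -(2 / 3) * (κ.im * (y 1).re) := by linarith
          refine mul_nonpos_of_nonneg_of_nonpos (energyWeight_one_nonneg _) ?_
          have : (darbouxWeight 1 * ((y 1).re ^ 2 + (y 1).im ^ 2)
            + ((χ 1).im * (y 1).re - (χ 1).re * (y 1).im) / κ.im)
            = -(1 / 3) * ((y 1).re ^ 2 + (y 1).im ^ 2) := by
            rw [ha, hb]
            norm_num [darbouxWeight]
            field_simp
            ring
          rw [this]
          nlinarith [sq_nonneg (y 1).re, sq_nonneg (y 1).im])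
    have hy0 : ∀ ρ ∈ Ioo (0 : ℝ) 1, y ρ = 0 := by
      intro ρ hρ
      have h2 := (mul_eq_zero.1 ((mul_eq_zero.1 (hN ρ hρ)).resolve_right
        (deriv_darbouxWeight_add_pos hκ hρ).ne')).resolve_left (energyWeight_pos κ.re hρ).ne'
      apply Complex.ext <;> simp only [Complex.zero_re, Complex.zero_im] <;> nlinarith
    intro ρ hρ
    have hz : y =ᶠ[nhds ρ] fun _ => 0 := by
      filter_upwards [isOpen_Ioo.mem_nhds hρ] with t ht using hy0 t ht
    have h2 := (hy ρ hρ).unique ((hasDerivAt_const ρ (0 : ℂ)).congr_of_eventuallyEq hz)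
    have hw : (darbouxWeight ρ : ℂ) ≠ 0 := by exact_mod_cast (darbouxWeight_pos hρ).ne'
    have hq : ((1 - ρ ^ 2 : ℝ) : ℂ) ≠ 0 := by exact_mod_cast (hsq ρ hρ).ne'
    rw [hy0 ρ hρ, mul_zero, zero_add, div_div] at h2
    exact (div_eq_zero_iff.1 h2).resolve_right (mul_ne_zero hw hq)

/-- The coefficient of the first-order operator `(1 - ρ ^ 2) ∂ + a` that annihilates
`(5 + 3 * ρ ^ 2)⁻²` for `κ = 0`. -/
noncomputable def darbouxCoeff (κ : ℂ) (ρ : ℝ) : ℂ :=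
  32 * ρ / (5 + 3 * (ρ : ℂ) ^ 2) - (4 + κ) * ρ

/-- The derivative of `darbouxCoeff`. -/
noncomputable def darbouxCoeffDeriv (κ : ℂ) (ρ : ℝ) : ℂ :=
  32 * (5 - 3 * (ρ : ℂ) ^ 2) / (5 + 3 * (ρ : ℂ) ^ 2) ^ 2 - (4 + κ)

lemma five_add_ne_zero (ρ : ℝ) : (5 + 3 * (ρ : ℂ) ^ 2) ≠ 0 := by
  have h : (5 + 3 * ρ ^ 2 : ℝ) ≠ 0 := by positivity
  exact_mod_cast h

lemma hasDerivAt_ofReal (ρ : ℝ) : HasDerivAt (fun t : ℝ => (t : ℂ)) 1 ρ :=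
  Complex.ofRealCLM.hasDerivAt

lemma hasDerivAt_five_add (ρ : ℝ) :
    HasDerivAt (fun t : ℝ => (5 + 3 * (t : ℂ) ^ 2 : ℂ)) (6 * ρ : ℂ) ρ := by
  refine ((((hasDerivAt_ofReal ρ).fun_pow 2).const_mul 3).const_add 5).congr_deriv ?_
  norm_num
  ring

lemma hasDerivAt_darbouxCoeff (κ : ℂ) (ρ : ℝ) :
    HasDerivAt (darbouxCoeff κ) (darbouxCoeffDeriv κ ρ) ρ := by
  have h5 := five_add_ne_zero ρ
  refine ((((hasDerivAt_ofReal ρ).const_mul 32).fun_div (hasDerivAt_five_add ρ) h5).fun_sub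
    ((hasDerivAt_ofReal ρ).const_mul (4 + κ))).congr_deriv ?_
  unfold darbouxCoeffDeriv
  field_simp
  ring

lemma continuous_darbouxCoeff (κ : ℂ) : Continuous (darbouxCoeff κ) :=
  continuous_iff_continuousAt.2 fun ρ => (hasDerivAt_darbouxCoeff κ ρ).continuousAt

lemma continuous_darbouxCoeffDeriv (κ : ℂ) : Continuous (darbouxCoeffDeriv κ) := by
  unfold darbouxCoeffDeriv
  refine (Continuous.div (by fun_prop) (by fun_prop) fun ρ => ?_).sub continuous_const
  exact pow_ne_zero 2 (five_add_ne_zero ρ)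

/-- The factor `(1 + ρ) ^ κ`. -/
noncomputable def outgoingFactor (κ : ℂ) (ρ : ℝ) : ℂ := Complex.exp (κ * Real.log (1 + ρ))

lemma hasDerivAt_outgoingFactor (κ : ℂ) {ρ : ℝ} (h : 0 ≤ ρ) :
    HasDerivAt (outgoingFactor κ) (outgoingFactor κ ρ * (κ / (1 + ρ))) ρ := by
  have hp : 1 + ρ ≠ 0 := by positivity
  refine ((((hasDerivAt_id ρ).const_add 1).log hp).ofReal_comp.const_mul κ).cexp.congr_deriv ?_
  simp [outgoingFactor, div_eq_mul_inv]

lemma outgoingFactor_ne_zero (κ : ℂ) (ρ : ℝ) : outgoingFactor κ ρ ≠ 0 := Complex.exp_ne_zero _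

lemma continuousOn_outgoingFactor (κ : ℂ) : ContinuousOn (outgoingFactor κ) (Icc 0 1) :=
  fun _ hρ => (hasDerivAt_outgoingFactor κ hρ.1).continuousAt.continuousWithinAt

section

variable (κ : ℂ) (f f₁ f₂ : ℝ → ℂ)

/-- The Darboux transform of `f`, with `f₁` in the role of the derivative of `f`. -/
noncomputable def darbouxTransform (ρ : ℝ) : ℂ :=
  (1 - (ρ : ℂ) ^ 2) * f₁ ρ + darbouxCoeff κ ρ * f ρ

/-- The derivative of `darbouxTransform`, with `f₂` in the role of the second derivative. -/
noncomputable def darbouxTransformDeriv (ρ : ℝ) : ℂ :=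
  (1 - (ρ : ℂ) ^ 2) * f₂ ρ + (darbouxCoeff κ ρ - 2 * ρ) * f₁ ρ + darbouxCoeffDeriv κ ρ * f ρ

variable {κ f f₁ f₂}

lemma hasDerivAt_darbouxTransform {ρ : ℝ} (hf : HasDerivAt f (f₁ ρ) ρ)
    (hf₁ : HasDerivAt f₁ (f₂ ρ) ρ) :
    HasDerivAt (darbouxTransform κ f f₁) (darbouxTransformDeriv κ f f₁ f₂ ρ) ρ := by
  refine ((((hasDerivAt_ofReal ρ).fun_pow 2).const_sub 1 |>.fun_mul hf₁).fun_add
    ((hasDerivAt_darbouxCoeff κ ρ).fun_mul hf)).congr_deriv ?_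
  unfold darbouxTransformDeriv
  norm_num
  ring

/-- The spectral equation, multiplied by `ρ` and written in terms of `κ = λ - 1`. -/
def SpectralEq (κ : ℂ) (f f₁ f₂ : ℝ → ℂ) (ρ : ℝ) : Prop :=
  -(1 - (ρ : ℂ) ^ 2) * ρ * f₂ ρ - (6 - 2 * (κ + 4) * (ρ : ℂ) ^ 2) * f₁ ρ
    + ρ * ((κ + 2) * (κ + 5) - (Vt ρ : ℂ)) * f ρ = 0

lemma ofReal_Vt (ρ : ℝ) : (Vt ρ : ℂ)
    = -2 * (9 * (ρ : ℂ) ^ 4 + 102 * (ρ : ℂ) ^ 2 - 335) / (5 + 3 * (ρ : ℂ) ^ 2) ^ 2 := by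
  simp [Vt]

/-- The first-order equation satisfied by the Darboux transform. -/
lemma SpectralEq.darbouxTransform_eq {ρ : ℝ} (h : SpectralEq κ f f₁ f₂ ρ) :
    (1 - (ρ : ℂ) ^ 2) * (ρ * darbouxTransformDeriv κ f f₁ f₂ ρ) = ρ * κ ^ 2 * f ρ
      - (3 * (1 - (ρ : ℂ) ^ 2) - κ * (ρ : ℂ) ^ 2
        + (1 - (ρ : ℂ) ^ 2) * (15 - 3 * (ρ : ℂ) ^ 2) / (5 + 3 * (ρ : ℂ) ^ 2))
        * darbouxTransform κ f f₁ ρ := by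
  have h5 := five_add_ne_zero ρ
  unfold SpectralEq at h
  rw [ofReal_Vt] at h
  unfold darbouxTransformDeriv darbouxTransform darbouxCoeff darbouxCoeffDeriv
  generalize (ρ : ℂ) = r at *
  obtain ⟨d, hd⟩ : ∃ d, d = 5 + 3 * r ^ 2 := ⟨_, rfl⟩
  rw [← hd] at h h5 ⊢
  field_simp at h ⊢
  subst hd
  linear_combination (-(1 - r ^ 2)) * h

/-- The algebraic identity behind the second-order equation for the Darboux transform `G` of `a`:
`a₁` and `G₁` are the derivatives of `a` and `G`, and `E` is `outgoingFactor`. -/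
lemma darboux_second_order_identity {r k a a₁ G G₁ E : ℂ} (hr : r ≠ 0) (hr₁ : 1 + r ≠ 0)
    (h5 : 5 + 3 * r ^ 2 ≠ 0) (hr₂ : 1 - r ^ 2 ≠ 0)
    (hG : G = (1 - r ^ 2) * a₁ + (32 * r / (5 + 3 * r ^ 2) - (4 + k) * r) * a)
    (hG₁ : (1 - r ^ 2) * (r * G₁) = r * k ^ 2 * a - (3 * (1 - r ^ 2) - k * r ^ 2
        + (1 - r ^ 2) * (15 - 3 * r ^ 2) / (5 + 3 * r ^ 2)) * G) :
    E * (k / (1 + r)) * (r ^ 3 * k ^ 2 * a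
        + (k * r ^ 3 - r ^ 2 * (1 - r ^ 2) * (15 - 3 * r ^ 2) / (5 + 3 * r ^ 2)) * G)
      + E * (3 * r ^ 2 * k ^ 2 * a + r ^ 3 * k ^ 2 * a₁
        + (3 * k * r ^ 2 - ((30 * r - 72 * r ^ 3 + 18 * r ^ 5) * (5 + 3 * r ^ 2)
          - (15 * r ^ 2 - 18 * r ^ 4 + 3 * r ^ 6) * (6 * r)) / (5 + 3 * r ^ 2) ^ 2) * G
        + (k * r ^ 3 - r ^ 2 * (1 - r ^ 2) * (15 - 3 * r ^ 2) / (5 + 3 * r ^ 2)) * G₁)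
      = 2 * k * (E * (r ^ 3 * k ^ 2 * a
        + (k * r ^ 3 - r ^ 2 * (1 - r ^ 2) * (15 - 3 * r ^ 2) / (5 + 3 * r ^ 2)) * G)
          / (1 - r ^ 2))
        + r ^ 3 * E * G / (r ^ 2 * (5 + 3 * r ^ 2) ^ 2
          / (6 * (50 - 15 * r ^ 2 - 3 * r ^ 6))) := by
  have ha₁ : a₁ = (G - (32 * r / (5 + 3 * r ^ 2) - (4 + k) * r) * a) / (1 - r ^ 2) := by
    rw [eq_div_iff hr₂, hG]
    ring
  have hG₁' : G₁ = (r * k ^ 2 * a - (3 * (1 - r ^ 2) - k * r ^ 2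
        + (1 - r ^ 2) * (15 - 3 * r ^ 2) / (5 + 3 * r ^ 2)) * G) / ((1 - r ^ 2) * r) := by
    rw [eq_div_iff (mul_ne_zero hr₂ hr), ← hG₁]
    ring
  rw [ha₁, hG₁', div_div_eq_mul_div]
  clear hG hG₁ ha₁ hG₁'
  have hr₃ : 1 - r ≠ 0 := fun h => hr₂ (by linear_combination (1 + r) * h)
  have hr₄ : 1 - r ^ 2 = (1 - r) * (1 + r) := by ring
  obtain ⟨d, hd⟩ : ∃ d, d = 5 + 3 * r ^ 2 := ⟨_, rfl⟩
  obtain ⟨m, hm⟩ : ∃ m, m = 1 - r := ⟨_, rfl⟩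
  obtain ⟨p, hp⟩ : ∃ p, p = 1 + r := ⟨_, rfl⟩
  rw [hr₄]
  rw [← hd] at h5 ⊢
  rw [← hm] at hr₃ ⊢
  rw [← hp] at hr₁ ⊢
  field_simp
  subst hd hm hp
  ring

lemma darbouxTransform_eq_zero (hκ : -1 ≤ κ.re) (hfc : ContinuousOn f (Icc 0 1))
    (hf₁c : ContinuousOn f₁ (Icc 0 1)) (hf₂c : ContinuousOn f₂ (Icc 0 1))
    (hf : ∀ ρ ∈ Ioo (0 : ℝ) 1, HasDerivAt f (f₁ ρ) ρ)
    (hf₁ : ∀ ρ ∈ Ioo (0 : ℝ) 1, HasDerivAt f₁ (f₂ ρ) ρ)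
    (h : ∀ ρ ∈ Icc (0 : ℝ) 1, SpectralEq κ f f₁ f₂ ρ) :
    ∀ ρ ∈ Ioo (0 : ℝ) 1, darbouxTransform κ f f₁ ρ = 0 := by
  have hr : Continuous fun t : ℝ => (t : ℂ) := Complex.continuous_ofReal
  have hGc : ContinuousOn (darbouxTransform κ f f₁) (Icc 0 1) :=
    ((by fun_prop : Continuous fun t : ℝ => 1 - (t : ℂ) ^ 2).continuousOn.mul hf₁c).add
      ((continuous_darbouxCoeff κ).continuousOn.mul hfc)
  have hG'c : ContinuousOn (darbouxTransformDeriv κ f f₁ f₂) (Icc 0 1) :=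
    (((by fun_prop : Continuous fun t : ℝ => 1 - (t : ℂ) ^ 2).continuousOn.mul hf₂c).add
      (((continuous_darbouxCoeff κ).sub (hr.const_mul 2)).continuousOn.mul hf₁c)).add
      ((continuous_darbouxCoeffDeriv κ).continuousOn.mul hfc)
  have hE := continuousOn_outgoingFactor κ
  have hp : ∀ ρ : ℝ, 0 ≤ ρ → (1 + ρ : ℂ) ≠ 0 := fun ρ hρ => by
    exact_mod_cast (by positivity : (1 + ρ : ℝ) ≠ 0)
  set χ : ℝ → ℂ := fun ρ => (ρ : ℂ) ^ 3 * outgoingFactor κ ρ * darbouxTransform κ f f₁ ρ with hχdef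
  set y : ℝ → ℂ := fun ρ => outgoingFactor κ ρ *
    ((3 * (ρ : ℂ) ^ 2 + (ρ : ℂ) ^ 3 * (κ / (1 + ρ))) * darbouxTransform κ f f₁ ρ
      + (ρ : ℂ) ^ 3 * darbouxTransformDeriv κ f f₁ f₂ ρ) with hydef
  have hfrac : ContinuousOn (fun ρ : ℝ => κ / (1 + ρ : ℂ)) (Icc 0 1) :=
    ContinuousOn.div (by fun_prop) (by fun_prop) fun ρ hρ => hp ρ hρ.1
  have hχ : ∀ ρ ∈ Ioo (0 : ℝ) 1, HasDerivAt χ (y ρ) ρ := fun ρ hρ => by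
    refine ((((hasDerivAt_ofReal ρ).fun_pow 3).fun_mul (hasDerivAt_outgoingFactor κ hρ.1.le)).fun_mul
      (hasDerivAt_darbouxTransform (hf ρ hρ) (hf₁ ρ hρ))).congr_deriv ?_
    simp only [hydef]
    norm_num
    ring
  have hsq : ∀ ρ ∈ Ioo (0 : ℝ) 1, (1 - (ρ : ℂ) ^ 2) ≠ 0 := fun ρ hρ => by
    exact_mod_cast (by nlinarith [hρ.1, hρ.2] : (1 - ρ ^ 2 : ℝ) ≠ 0)
  have hyeq : ∀ ρ ∈ Ioo (0 : ℝ) 1, y ρ = outgoingFactor κ ρ * ((ρ : ℂ) ^ 3 * κ ^ 2 * f ρ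
      + (κ * (ρ : ℂ) ^ 3 - (ρ : ℂ) ^ 2 * (1 - (ρ : ℂ) ^ 2) * (15 - 3 * (ρ : ℂ) ^ 2)
        / (5 + 3 * (ρ : ℂ) ^ 2)) * darbouxTransform κ f f₁ ρ) / (1 - (ρ : ℂ) ^ 2) := by
    intro ρ hρ
    have key := (h ρ (Ioo_subset_Icc_self hρ)).darbouxTransform_eq
    rw [eq_div_iff (hsq ρ hρ)]
    have h5 := five_add_ne_zero ρ
    have h1 := hp ρ hρ.1.le
    simp only [hydef]
    field_simp at key ⊢
    linear_combination (ρ : ℂ) ^ 2 * (1 + ρ) * outgoingFactor κ ρ * key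
  have hy : ∀ ρ ∈ Ioo (0 : ℝ) 1, HasDerivAt y
      ((2 * (ρ + κ) * y ρ + χ ρ / (darbouxWeight ρ : ℂ)) / ((1 - ρ ^ 2 : ℝ) : ℂ)) ρ := by
    intro ρ hρ
    have hid := hasDerivAt_ofReal ρ
    have h5 := five_add_ne_zero ρ
    have hρ0 : (ρ : ℂ) ≠ 0 := by exact_mod_cast hρ.1.ne'
    have hB : HasDerivAt (fun t : ℝ => (t : ℂ) ^ 2 * (1 - (t : ℂ) ^ 2) * (15 - 3 * (t : ℂ) ^ 2)
        / (5 + 3 * (t : ℂ) ^ 2)) (((30 * ρ - 72 * (ρ : ℂ) ^ 3 + 18 * (ρ : ℂ) ^ 5)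
          * (5 + 3 * (ρ : ℂ) ^ 2) - (15 * (ρ : ℂ) ^ 2 - 18 * (ρ : ℂ) ^ 4 + 3 * (ρ : ℂ) ^ 6)
          * (6 * ρ)) / (5 + 3 * (ρ : ℂ) ^ 2) ^ 2) ρ := by
      refine ((((hid.fun_pow 2).fun_mul ((hid.fun_pow 2).const_sub 1)).fun_mul
        (((hid.fun_pow 2).const_mul 3).const_sub 15)).fun_div
          (hasDerivAt_five_add ρ) h5).congr_deriv ?_
      congr 1
      norm_num
      ring
    have hH := (hasDerivAt_outgoingFactor κ hρ.1.le).fun_mul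
      ((((hid.fun_pow 3).mul_const (κ ^ 2)).fun_mul (hf ρ hρ)).fun_add
        ((((hid.fun_pow 3).const_mul κ).fun_sub hB).fun_mul
          (hasDerivAt_darbouxTransform (κ := κ) (hf ρ hρ) (hf₁ ρ hρ))))
    have hyd := hH.fun_div ((hid.fun_pow 2).const_sub 1) (hsq ρ hρ)
    refine (hyd.congr_of_eventuallyEq ?_).congr_deriv ?_
    · filter_upwards [isOpen_Ioo.mem_nhds hρ] with t ht using hyeq t ht
    · have key := darboux_second_order_identity (E := outgoingFactor κ ρ) hρ0 (hp ρ hρ.1.le) h5 (hsq ρ hρ)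
        (rfl : darbouxTransform κ f f₁ ρ = _)
        (h ρ (Ioo_subset_Icc_self hρ)).darbouxTransform_eq
      have hs := hsq ρ hρ
      have hyr := hyeq ρ hρ
      rw [← hyr] at key
      have hcast : (darbouxWeight ρ : ℂ) = (ρ : ℂ) ^ 2 * (5 + 3 * (ρ : ℂ) ^ 2) ^ 2
          / (6 * (50 - 15 * (ρ : ℂ) ^ 2 - 3 * (ρ : ℂ) ^ 6)) := by
        simp [darbouxWeight]
      rw [← hcast] at key
      have hs' : ((1 - ρ ^ 2 : ℝ) : ℂ) = 1 - (ρ : ℂ) ^ 2 := by push_cast; rfl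
      rw [hs', div_eq_div_iff (pow_ne_zero 2 hs) hs]
      rw [eq_div_iff hs] at hyr
      rw [← hyr]
      norm_num
      linear_combination (1 - (ρ : ℂ) ^ 2) ^ 2 * key
  have hone : -2 * (1 + κ) * y 1 = 3 * χ 1 := by
    have h1 := h 1 (by simp)
    unfold SpectralEq at h1
    rw [ofReal_Vt] at h1
    simp only [hydef, hχdef, darbouxTransform, darbouxTransformDeriv, darbouxCoeff,
      darbouxCoeffDeriv]
    norm_num at h1 ⊢
    linear_combination (-(2 + κ)) * outgoingFactor κ 1 * h1
  intro ρ hρ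
  have hz := darboux_solution_eq_zero hκ (χ := χ) (y := y)
    (((hr.pow 3).continuousOn.mul hE).mul hGc)
    (hE.mul ((((hr.pow 2).const_mul 3).continuousOn.add ((hr.pow 3).continuousOn.mul hfrac)).mul hGc
      |>.add ((hr.pow 3).continuousOn.mul hG'c)))
    (by simp [hχdef]) hχ hy hone ρ hρ
  have hρ0 : (ρ : ℂ) ≠ 0 := by exact_mod_cast hρ.1.ne'
  exact (mul_eq_zero.1 hz).resolve_left (mul_ne_zero (pow_ne_zero 3 hρ0) (outgoingFactor_ne_zero κ ρ))

end

/-- Mode stability: any nontrivial solution of the spectral ODE which is smooth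
on `[0,1]`, for `Re λ ≥ 0`, forces `λ = 1` and `f(ρ) = c(5+3ρ²)⁻²` with `c ≠ 0`. -/
theorem stmt_9 (lam : ℂ) (hlam : 0 ≤ lam.re) (f : ℝ → ℂ)
    (hf : ContDiffOn ℝ (⊤ : ℕ∞) f (Set.Icc 0 1))
    (hne : ∃ ρ ∈ Set.Icc (0 : ℝ) 1, f ρ ≠ 0)
    (hode : ∀ ρ ∈ Set.Ioo (0 : ℝ) 1,
      -((1 - ρ ^ 2 : ℝ) : ℂ) * deriv (deriv f) ρ
        - (((6 / ρ : ℝ) : ℂ) - 2 * (lam + 3) * (ρ : ℂ)) * deriv f ρ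
        + ((lam + 1) * (lam + 4) - (Vt ρ : ℂ)) * f ρ = 0) :
    lam = 1 ∧ ∃ c : ℂ, c ≠ 0 ∧ ∀ ρ ∈ Set.Icc (0 : ℝ) 1,
      f ρ = c * (((5 + 3 * ρ ^ 2 : ℝ) : ℂ) ^ 2)⁻¹ := by
  have hu : UniqueDiffOn ℝ (Icc (0 : ℝ) 1) := uniqueDiffOn_Icc one_pos
  set f₁ := derivWithin f (Icc 0 1) with hf₁def
  set f₂ := derivWithin f₁ (Icc 0 1) with hf₂def
  have hsmooth₁ : ContDiffOn ℝ (⊤ : ℕ∞) f₁ (Icc 0 1) :=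
    ((contDiffOn_infty_iff_derivWithin hu).1 hf).2
  have hsmooth₂ : ContDiffOn ℝ (⊤ : ℕ∞) f₂ (Icc 0 1) :=
    ((contDiffOn_infty_iff_derivWithin hu).1 hsmooth₁).2
  have hderiv : ∀ {g : ℝ → ℂ}, ContDiffOn ℝ (⊤ : ℕ∞) g (Icc 0 1) → ∀ ρ ∈ Ioo (0 : ℝ) 1,
      HasDerivAt g (derivWithin g (Icc 0 1) ρ) ρ := fun hg ρ hρ =>
    (((contDiffOn_infty_iff_derivWithin hu).1 hg).1 ρ
      (Ioo_subset_Icc_self hρ)).hasDerivWithinAt.hasDerivAt (Icc_mem_nhds hρ.1 hρ.2)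
  have hd := hderiv hf
  have hd₁ := hderiv hsmooth₁
  have hextend : ∀ {g : ℝ → ℂ}, ContinuousOn g (Icc 0 1) → (∀ ρ ∈ Ioo (0 : ℝ) 1, g ρ = 0) →
      ∀ ρ ∈ Icc (0 : ℝ) 1, g ρ = 0 := by
    intro g hg hz
    have hcl := closure_Ioo (zero_ne_one' ℝ)
    exact (show EqOn g (fun _ => 0) (Ioo 0 1) from hz).of_subset_closure hg continuousOn_const
      Ioo_subset_Icc_self hcl.ge
  obtain ⟨κ, rfl⟩ : ∃ κ : ℂ, lam = κ + 1 := ⟨lam - 1, by ring⟩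
  have hκ : -1 ≤ κ.re := by
    simp at hlam
    linarith
  have hVc : Continuous fun ρ : ℝ => (Vt ρ : ℂ) := by
    refine Complex.continuous_ofReal.comp ?_
    unfold Vt
    exact Continuous.div (by fun_prop) (by fun_prop) fun ρ => by positivity
  have hspec : ∀ ρ ∈ Icc (0 : ℝ) 1, SpectralEq κ f f₁ f₂ ρ := by
    have hc := hf.continuousOn
    have hc₁ := hsmooth₁.continuousOn
    have hc₂ := hsmooth₂.continuousOn
    refine hextend (by fun_prop) fun ρ hρ => ?_
    have he₁ : deriv f =ᶠ[nhds ρ] f₁ := by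
      filter_upwards [isOpen_Ioo.mem_nhds hρ] with t ht using (hd t ht).deriv
    have hρ0 : (ρ : ℂ) ≠ 0 := by exact_mod_cast hρ.1.ne'
    have h0 := hode ρ hρ
    rw [he₁.deriv_eq, he₁.eq_of_nhds, (hd₁ ρ hρ).deriv] at h0
    push_cast at h0
    field_simp at h0
    linear_combination h0
  have hG := darbouxTransform_eq_zero hκ hf.continuousOn hsmooth₁.continuousOn
    hsmooth₂.continuousOn hd hd₁ hspec
  have hκf : ∀ ρ ∈ Ioo (0 : ℝ) 1, κ ^ 2 * f ρ = 0 := by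
    intro ρ hρ
    have hz : darbouxTransform κ f f₁ =ᶠ[nhds ρ] fun _ => 0 := by
      filter_upwards [isOpen_Ioo.mem_nhds hρ] with t ht using hG t ht
    have hG' := (hasDerivAt_darbouxTransform (hd ρ hρ) (hd₁ ρ hρ)).unique
      ((hasDerivAt_const ρ (0 : ℂ)).congr_of_eventuallyEq hz)
    have key := (hspec ρ (Ioo_subset_Icc_self hρ)).darbouxTransform_eq
    have hρ0 : (ρ : ℂ) ≠ 0 := by exact_mod_cast hρ.1.ne'
    rw [hG', hG ρ hρ] at key
    refine (mul_eq_zero.1 (?_ : (ρ : ℂ) * (κ ^ 2 * f ρ) = 0)).resolve_left hρ0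
    linear_combination -key
  have hκ0 : κ = 0 := by
    by_contra hκ0
    obtain ⟨ρ, hρ, hfρ⟩ := hne
    exact hfρ (hextend hf.continuousOn
      (fun t ht => (mul_eq_zero.1 (hκf t ht)).resolve_left (pow_ne_zero 2 hκ0)) ρ hρ)
  subst hκ0
  refine ⟨by simp, ?_⟩
  set F : ℝ → ℂ := fun ρ => f ρ * (5 + 3 * (ρ : ℂ) ^ 2) ^ 2 with hFdef
  have hFc : ContinuousOn F (Icc 0 1) :=
    hf.continuousOn.mul (by fun_prop)
  have hF : ∀ ρ ∈ Icc (0 : ℝ) 1, F ρ = F 0 := by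
    have hFd : ∀ ρ ∈ Ioo (0 : ℝ) 1, HasDerivAt F 0 ρ := fun ρ hρ => by
      refine ((hd ρ hρ).fun_mul ((hasDerivAt_five_add ρ).fun_pow 2)).congr_deriv ?_
      have h0 := hG ρ hρ
      have h5 := five_add_ne_zero ρ
      have hs : (1 - (ρ : ℂ) ^ 2) ≠ 0 := by
        exact_mod_cast (by nlinarith [hρ.1, hρ.2] : (1 - ρ ^ 2 : ℝ) ≠ 0)
      unfold darbouxTransform darbouxCoeff at h0
      refine mul_left_cancel₀ hs ?_
      norm_num [-mul_eq_zero]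
      have h1 : 32 * (ρ : ℂ) / (5 + 3 * (ρ : ℂ) ^ 2) * (5 + 3 * (ρ : ℂ) ^ 2) = 32 * ρ :=
        div_mul_cancel₀ _ h5
      linear_combination (5 + 3 * (ρ : ℂ) ^ 2) ^ 2 * h0 - (5 + 3 * (ρ : ℂ) ^ 2) * f ρ * h1
    obtain ⟨c, hc⟩ := isOpen_Ioo.exists_is_const_of_deriv_eq_zero isPreconnected_Ioo
      (fun ρ hρ => (hFd ρ hρ).differentiableAt.differentiableWithinAt)
      (fun ρ hρ => (hFd ρ hρ).deriv)
    have hcc := hextend (hFc.sub continuousOn_const) fun ρ hρ => sub_eq_zero.2 (hc ρ hρ)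
    intro ρ hρ
    rw [sub_eq_zero.1 (hcc ρ hρ), sub_eq_zero.1 (hcc 0 (left_mem_Icc.2 zero_le_one))]
  have hval : ∀ ρ ∈ Icc (0 : ℝ) 1, f ρ = F 0 * (((5 + 3 * ρ ^ 2 : ℝ) : ℂ) ^ 2)⁻¹ := by
    intro ρ hρ
    rw [← hF ρ hρ, eq_mul_inv_iff_mul_eq₀]
    · simp [hFdef]
    · exact_mod_cast pow_ne_zero 2 (five_add_ne_zero ρ)
  refine ⟨F 0, fun h0 => ?_, hval⟩
  obtain ⟨ρ, hρ, hfρ⟩ := hne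
  exact hfρ (by rw [hval ρ hρ, h0, zero_mul])
end
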